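/- arXiv:2212.00708 — 2 statements merged into one kernel-verified Lean document; each statement's English description precedes it below -/
import Mathlib

section
/- Let A be maximally dissipative on H with boundary operator Γ. Then for all u ∈ H and ε > 0: ∫_ℝ ‖Γ(A − k + iε)^{-1}u‖²_E dk = 2π‖u‖²_H − 2ε ∫_ℝ ‖(A − k + iε)^{-1}u‖²_H dk. -/
open Complex MeasureTheory

noncomputable section

variable {H : Type*} [NormedAddCommGroup H] [InnerProductSpace ℂ H] [CompleteSpace H]

local notation "⟪" x ", " y "⟫" => @inner ℂ _ _ x y

/-- `A` is dissipative: densely defined with `Im ⟨Au,u⟩ ≥ 0`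
(the paper's inner product is linear in the first slot, so `⟨Au,u⟩ = ⟪u, Au⟫` in
Mathlib's convention). -/
def IsDissipative (A : H →ₗ.[ℂ] H) : Prop :=
  Dense (A.domain : Set H) ∧ ∀ u : A.domain, 0 ≤ (⟪(u : H), A u⟫).im

/-- Maximally dissipative: dissipative with no nontrivial dissipative extension. -/
def IsMaxDissipative (A : H →ₗ.[ℂ] H) : Prop :=
  IsDissipative A ∧ ∀ B : H →ₗ.[ℂ] H, IsDissipative B → A ≤ B → B = A

/-- `R` is the everywhere-defined bounded resolvent `(A - z)⁻¹` of `A`. -/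
def IsResolventAt (A : H →ₗ.[ℂ] H) (z : ℂ) (R : H →L[ℂ] H) : Prop :=
  (∀ u : A.domain, R (A u - z • (u : H)) = (u : H)) ∧
  ∀ h : H, ∃ u : A.domain, (u : H) = R h ∧ A u - z • (u : H) = h

open Filter Topology in
lemma aux_contour (g : ℂ → ℂ) (C ε : ℝ) (hε : 0 < ε) (hC : 0 ≤ C)
    (hg : ∀ z : ℂ, z.im < 0 → DifferentiableAt ℂ g z)
    (hb : ∀ z : ℂ, z.im < 0 → ‖g z‖ * (-z.im) ≤ C) :
    Tendsto (fun n : ℕ => ∫ k in (-((n : ℝ) ^ 4))..((n : ℝ) ^ 4),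
      g ((k : ℂ) - ε * Complex.I) / ((k : ℂ) - ε * Complex.I)) atTop (𝓝 0) := by
  have hbd : ∀ (z : ℂ) (a b : ℝ), 0 < a → 0 < b → a ≤ -z.im → b ≤ ‖z‖ →
      ‖g z / z‖ ≤ C / a / b := by
    intro z a b ha hb' h1 h2
    rw [norm_div]
    have h3 : ‖g z‖ ≤ C / a := by
      rw [le_div_iff₀ ha]
      exact le_trans (by gcongr) (hb z (by linarith))
    gcongr
  have hmain : ∀ n : ℕ, 1 ≤ n → ‖∫ k in (-((n : ℝ) ^ 4))..((n : ℝ) ^ 4),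
      g ((k : ℂ) - ε * Complex.I) / ((k : ℂ) - ε * Complex.I)‖ ≤
      (2 * C + 2 * C / ε) * (1 / (n : ℝ)) := by
    intro n hn
    have hn' : (1 : ℝ) ≤ n := by exact_mod_cast hn
    have hn0 : (0 : ℝ) < n := by linarith
    have h := Complex.integral_boundary_rect_eq_zero_of_differentiableOn (fun z => g z / z)
      ⟨-((n : ℝ) ^ 4), -ε⟩ ⟨(n : ℝ) ^ 4, -(ε + (n : ℝ) ^ 3)⟩ ?_
    · simp only at h
      have e1 : ∀ k : ℝ, (k : ℂ) + ((-ε : ℝ) : ℂ) * Complex.I = (k : ℂ) - ε * Complex.I := by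
        intro k; push_cast; ring
      simp only [e1] at h
      set T := ∫ k in (-((n : ℝ) ^ 4))..((n : ℝ) ^ 4),
        g ((k : ℂ) - ε * Complex.I) / ((k : ℂ) - ε * Complex.I)
      have hB : ‖∫ x in (-((n : ℝ) ^ 4))..((n : ℝ) ^ 4),
          g ((x : ℂ) + ((-(ε + (n : ℝ) ^ 3) : ℝ) : ℂ) * Complex.I) /
            ((x : ℂ) + ((-(ε + (n : ℝ) ^ 3) : ℝ) : ℂ) * Complex.I)‖ ≤
          C / (n : ℝ) ^ 3 / (n : ℝ) ^ 3 * |(n : ℝ) ^ 4 - (-((n : ℝ) ^ 4))| := by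
        apply intervalIntegral.norm_integral_le_of_norm_le_const
        intro x _
        have him : ((x : ℂ) + ((-(ε + (n : ℝ) ^ 3) : ℝ) : ℂ) * Complex.I).im
            = -(ε + (n : ℝ) ^ 3) := by
          rw [Complex.add_im, Complex.ofReal_im, Complex.im_ofReal_mul, Complex.I_im]; ring
        apply hbd _ _ _ (by positivity) (by positivity)
        · rw [him]; linarith
        · refine le_trans ?_ (Complex.abs_im_le_norm _)
          rw [him, abs_neg]
          exact le_trans (by linarith) (le_abs_self _)
      have hS : ∀ s : ℝ, |s| = (n : ℝ) ^ 4 → ‖∫ y in (-ε)..(-(ε + (n : ℝ) ^ 3)),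
          g ((s : ℂ) + (y : ℂ) * Complex.I) / ((s : ℂ) + (y : ℂ) * Complex.I)‖ ≤
          C / ε / (n : ℝ) ^ 4 * |(-(ε + (n : ℝ) ^ 3)) - (-ε)| := by
        intro s hs
        apply intervalIntegral.norm_integral_le_of_norm_le_const
        intro y hy
        have hn3 : 0 < (n : ℝ) ^ 3 := by positivity
        rw [Set.uIoc_of_ge (by linarith)] at hy
        apply hbd _ _ _ (by positivity) (by positivity)
        · simpa using by linarith [hy.2]
        · refine le_trans ?_ (Complex.abs_re_le_norm _)
          simp [hs]
      have hS1 := hS ((n : ℝ) ^ 4) (abs_of_nonneg (by positivity))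
      have hS2 := hS (-((n : ℝ) ^ 4)) (by rw [abs_neg]; exact abs_of_nonneg (by positivity))
      have a1 : |(n : ℝ) ^ 4 - (-((n : ℝ) ^ 4))| = 2 * (n : ℝ) ^ 4 := by
        rw [show (n : ℝ) ^ 4 - (-((n : ℝ) ^ 4)) = 2 * (n : ℝ) ^ 4 by ring]
        exact abs_of_nonneg (by positivity)
      have a2 : |(-(ε + (n : ℝ) ^ 3)) - (-ε)| = (n : ℝ) ^ 3 := by
        rw [show (-(ε + (n : ℝ) ^ 3)) - (-ε) = -((n : ℝ) ^ 3) by ring, abs_neg]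
        exact abs_of_nonneg (by positivity)
      rw [a1] at hB
      rw [a2] at hS1 hS2
      set B := ∫ x in (-((n : ℝ) ^ 4))..((n : ℝ) ^ 4),
          g ((x : ℂ) + ((-(ε + (n : ℝ) ^ 3) : ℝ) : ℂ) * Complex.I) /
            ((x : ℂ) + ((-(ε + (n : ℝ) ^ 3) : ℝ) : ℂ) * Complex.I)
      set S1 := ∫ y in (-ε)..(-(ε + (n : ℝ) ^ 3)),
          g ((((n : ℝ) ^ 4 : ℝ) : ℂ) + (y : ℂ) * Complex.I) /
            ((((n : ℝ) ^ 4 : ℝ) : ℂ) + (y : ℂ) * Complex.I)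
      set S2 := ∫ y in (-ε)..(-(ε + (n : ℝ) ^ 3)),
          g (((-((n : ℝ) ^ 4) : ℝ) : ℂ) + (y : ℂ) * Complex.I) /
            (((-((n : ℝ) ^ 4) : ℝ) : ℂ) + (y : ℂ) * Complex.I)
      have hT : T = B - Complex.I • S1 + Complex.I • S2 := by
        linear_combination h
      have hT2 : ‖T‖ ≤ ‖B‖ + ‖S1‖ + ‖S2‖ := by
        rw [hT]
        refine (norm_add_le _ _).trans ?_
        have := norm_sub_le B (Complex.I • S1)
        simp only [norm_smul, Complex.norm_I, one_mul] at this ⊢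
        linarith
      have b1 : C / (n : ℝ) ^ 3 / (n : ℝ) ^ 3 * (2 * (n : ℝ) ^ 4) ≤ 2 * C * (1 / n) := by
        have : C / (n : ℝ) ^ 3 / (n : ℝ) ^ 3 * (2 * (n : ℝ) ^ 4) = 2 * C * (1 / n) * (1 / n) := by
          field_simp
        rw [this]
        apply mul_le_of_le_one_right (by positivity)
        rw [div_le_one hn0]; exact hn'
      have b2 : C / ε / (n : ℝ) ^ 4 * (n : ℝ) ^ 3 = C / ε * (1 / n) := by
        field_simp
      rw [b2] at hS1 hS2
      have : (2 * C + 2 * C / ε) * (1 / (n : ℝ)) =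
        2 * C * (1 / n) + C / ε * (1 / n) + C / ε * (1 / n) := by ring
      linarith
    · intro z hz
      have him : z.im < 0 := by
        have h2 := hz.2
        have hn3 : 0 < (n : ℝ) ^ 3 := by positivity
        simp only [Set.mem_preimage] at h2
        rw [Set.uIcc_of_ge (by linarith)] at h2
        linarith [h2.2]
      have hz0 : z ≠ 0 := by rintro rfl; simp at him
      exact ((hg z him).div differentiableAt_id hz0).differentiableWithinAt
  have hlim : Tendsto (fun n : ℕ => (2 * C + 2 * C / ε) * (1 / (n : ℝ))) atTop (𝓝 0) := by
    simpa using (tendsto_one_div_atTop_nhds_zero_nat (𝕜 := ℝ)).const_mul (2 * C + 2 * C / ε)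
  refine squeeze_zero_norm' ?_ hlim
  filter_upwards [eventually_ge_atTop 1] with n hn using hmain n hn

lemma aux_res_sub (A : H →ₗ.[ℂ] H) (R : ℂ → H →L[ℂ] H)
    (hR : ∀ z : ℂ, z.im < 0 → IsResolventAt A z (R z)) (z w : ℂ) (hz : z.im < 0) (hw : w.im < 0)
    (x : H) : R z x - R w x = (z - w) • R z (R w x) := by
  obtain ⟨a, ha, hx⟩ := (hR w hw).2 x
  have h1 := (hR z hz).1 a
  rw [← ha]
  have h2 : A a - z • (a : H) = x - (z - w) • (a : H) := by
    rw [← hx, sub_smul]; abel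
  rw [h2, map_sub, map_smul] at h1
  rw [sub_eq_iff_eq_add] at h1 ⊢
  rw [h1, add_comm]

open Filter Topology in
lemma aux_res_deriv (A : H →ₗ.[ℂ] H) (R : ℂ → H →L[ℂ] H)
    (hR : ∀ z : ℂ, z.im < 0 → IsResolventAt A z (R z))
    (hb : ∀ z : ℂ, z.im < 0 → ∀ x, ‖R z x‖ * (-z.im) ≤ ‖x‖)
    (w : ℂ) (hw : w.im < 0) (x : H) : DifferentiableAt ℂ (fun z => R z x) w := by
  have hnear : ∀ᶠ z : ℂ in 𝓝 w, z.im < w.im / 2 :=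
    Complex.continuous_im.continuousAt.eventually_lt continuousAt_const (by linarith)
  have hcont : ∀ y : H, ContinuousAt (fun z => R z y) w := by
    intro y
    rw [ContinuousAt, tendsto_iff_norm_sub_tendsto_zero]
    have hlim : Tendsto (fun z : ℂ => ‖z - w‖ * (‖R w y‖ / (-(w.im / 2)))) (𝓝 w) (𝓝 0) := by
      have : Continuous (fun z : ℂ => ‖z - w‖ * (‖R w y‖ / (-(w.im / 2)))) := by fun_prop
      simpa using this.tendsto w
    refine squeeze_zero' (Eventually.of_forall fun _ => norm_nonneg _) ?_ hlim
    filter_upwards [hnear] with z hz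
    have hz0 : z.im < 0 := by linarith
    rw [aux_res_sub A R hR z w hz0 hw, norm_smul]
    gcongr
    rw [le_div_iff₀ (by linarith)]
    refine le_trans ?_ (hb z hz0 (R w y))
    gcongr
  have : HasDerivAt (fun z => R z x) (R w (R w x)) w := by
    rw [hasDerivAt_iff_tendsto_slope]
    refine Tendsto.congr' ?_ ((hcont (R w x)).tendsto.mono_left nhdsWithin_le_nhds)
    filter_upwards [self_mem_nhdsWithin, nhdsWithin_le_nhds hnear] with z hz1 hz2
    have hzw : z - w ≠ 0 := sub_ne_zero.mpr hz1
    rw [slope_def_module, aux_res_sub A R hR z w (by linarith) hw, smul_smul,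
      inv_mul_cancel₀ hzw, one_smul]
  exact this.differentiableAt

lemma aux_green
    {E : Type*} [NormedAddCommGroup E] [InnerProductSpace ℂ E]
    (A : H →ₗ.[ℂ] H) (Γ : A.domain →ₗ[ℂ] E)
    (hLag : ∀ u v : A.domain, ⟪(v : H), A u⟫ - ⟪A v, (u : H)⟫ = Complex.I * ⟪Γ v, Γ u⟫)
    (R : ℂ → H →L[ℂ] H) (hR : ∀ z : ℂ, z.im < 0 → IsResolventAt A z (R z))
    (G : ℂ → H →L[ℂ] E)
    (hG : ∀ z : ℂ, z.im < 0 → ∀ u : A.domain, G z (A u - z • (u : H)) = Γ u)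
    (z : ℂ) (hz : z.im < 0) (x : H) :
    ‖G z x‖ ^ 2 + 2 * (-z.im) * ‖R z x‖ ^ 2 = -2 * (⟪x, R z x⟫).im := by
  obtain ⟨a, ha, hx⟩ := (hR z hz).2 x
  have hg := hG z hz a
  rw [hx] at hg
  have hl := hLag a a
  have hAa : A a = x + z • (a : H) := by rw [← hx]; abel
  rw [hg, ← ha]
  rw [hAa, inner_add_left, inner_add_right, inner_smul_left, inner_smul_right,
    inner_self_eq_norm_sq_to_K, inner_self_eq_norm_sq_to_K, ← inner_conj_symm (a : H) x] at hl
  have := congrArg Complex.im hl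
  simp [← Complex.ofReal_pow, -inner_conj_symm] at this
  linarith

open Filter Topology in
lemma aux_dom
    {E : Type*} [NormedAddCommGroup E] [InnerProductSpace ℂ E]
    (A : H →ₗ.[ℂ] H) (Γ : A.domain →ₗ[ℂ] E)
    (hLag : ∀ u v : A.domain, ⟪(v : H), A u⟫ - ⟪A v, (u : H)⟫ = Complex.I * ⟪Γ v, Γ u⟫)
    (R : ℂ → H →L[ℂ] H) (hR : ∀ z : ℂ, z.im < 0 → IsResolventAt A z (R z))
    (G : ℂ → H →L[ℂ] E)
    (hG : ∀ z : ℂ, z.im < 0 → ∀ u : A.domain, G z (A u - z • (u : H)) = Γ u)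
    (hb : ∀ z : ℂ, z.im < 0 → ∀ x, ‖R z x‖ * (-z.im) ≤ ‖x‖)
    (ε : ℝ) (hε : 0 < ε) (a : A.domain)
    (hc : ∀ x, Continuous (fun k : ℝ => R ((k : ℂ) - ε * Complex.I) x)) :
    Integrable (fun k : ℝ => -2 * (⟪(a : H), R ((k : ℂ) - ε * Complex.I) a⟫).im) ∧
    ∫ k : ℝ, -2 * (⟪(a : H), R ((k : ℂ) - ε * Complex.I) a⟫).im = 2 * Real.pi * ‖(a : H)‖ ^ 2 := by
  have him : ∀ k : ℝ, ((k : ℂ) - ε * Complex.I).im = -ε := by intro k; simp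
  have hne : ∀ k : ℝ, ((k : ℂ) - ε * Complex.I) ≠ 0 := by
    intro k h
    have := him k
    rw [h] at this
    simp at this; linarith
  let g : ℂ → ℂ := fun z => ⟪(a : H), R z (A a)⟫
  have hgc : Continuous fun k : ℝ => g ((k : ℂ) - ε * Complex.I) / ((k : ℂ) - ε * Complex.I) :=
    Continuous.div (Continuous.inner continuous_const (hc _)) (by fun_prop) hne
  have h0 := aux_contour g (‖(a : H)‖ * ‖A a‖) ε hε (by positivity)
    (fun z hz => (innerSL ℂ (a : H)).differentiableAt.comp z (aux_res_deriv A R hR hb z hz (A a)))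
    (fun z hz => by
      have h1 : ‖g z‖ ≤ ‖(a : H)‖ * ‖R z (A a)‖ := norm_inner_le_norm _ _
      have h2 := hb z hz (A a)
      calc ‖g z‖ * (-z.im) ≤ ‖(a : H)‖ * ‖R z (A a)‖ * (-z.im) := by
            apply mul_le_mul_of_nonneg_right h1; linarith
        _ = ‖(a : H)‖ * (‖R z (A a)‖ * (-z.im)) := by ring
        _ ≤ _ := by gcongr)
  have hker : ∀ k : ℝ, ε / (k ^ 2 + ε ^ 2) = ε⁻¹ * (1 + (k / ε) ^ 2)⁻¹ := by
    intro k
    have : k ^ 2 + ε ^ 2 ≠ 0 := by positivity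
    have h2 : 1 + (k / ε) ^ 2 ≠ 0 := by positivity
    field_simp
    ring
  have hki : Integrable fun k : ℝ => ε / (k ^ 2 + ε ^ 2) := by
    simp only [hker]
    exact (integrable_inv_one_add_sq.comp_div hε.ne').const_mul _
  have hkv : ∫ k : ℝ, ε / (k ^ 2 + ε ^ 2) = Real.pi := by
    simp only [hker]
    rw [integral_const_mul, Measure.integral_comp_div (fun x : ℝ => (1 + x ^ 2)⁻¹),
      integral_univ_inv_one_add_sq, abs_of_pos hε, smul_eq_mul, ← mul_assoc,
      inv_mul_cancel₀ hε.ne', one_mul]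
  have hpt : ∀ k : ℝ, -2 * (⟪(a : H), R ((k : ℂ) - ε * Complex.I) a⟫).im =
      -2 * (g ((k : ℂ) - ε * Complex.I) / ((k : ℂ) - ε * Complex.I)).im +
        2 * ‖(a : H)‖ ^ 2 * (ε / (k ^ 2 + ε ^ 2)) := by
    intro k
    have hz : ((k : ℂ) - ε * Complex.I).im < 0 := by rw [him]; linarith
    have hinv : (((k : ℂ) - ε * Complex.I)⁻¹).im = ε / (k ^ 2 + ε ^ 2) := by
      rw [Complex.inv_im, him, Complex.normSq_apply, him]; simp; ring
    have hz0 := hne k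
    set z := (k : ℂ) - ε * Complex.I
    have h1 := (hR z hz).1 a
    rw [map_sub, map_smul] at h1
    have h2 : g z - z * ⟪(a : H), R z a⟫ = (‖(a : H)‖ : ℂ) ^ 2 := by
      have := congrArg (fun y => ⟪(a : H), y⟫) h1
      simp only [inner_sub_right, inner_smul_right, inner_self_eq_norm_sq_to_K] at this
      exact this
    have h3 : ⟪(a : H), R z a⟫ = g z / z - ((‖(a : H)‖ ^ 2 : ℝ) : ℂ) * z⁻¹ := by
      field_simp
      push_cast
      linear_combination -h2
    rw [h3, Complex.sub_im, Complex.im_ofReal_mul, hinv]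
    ring
  have hKt : Tendsto (fun n : ℕ => (n : ℝ) ^ 4) atTop atTop :=
    (tendsto_pow_atTop (by norm_num)).comp tendsto_natCast_atTop_atTop
  have hKb : Tendsto (fun n : ℕ => -((n : ℝ) ^ 4)) atTop atBot :=
    tendsto_neg_atTop_atBot.comp hKt
  have hΦc : Continuous fun k : ℝ => -2 * (⟪(a : H), R ((k : ℂ) - ε * Complex.I) a⟫).im :=
    continuous_const.mul (Complex.continuous_im.comp (Continuous.inner continuous_const (hc _)))
  have hlim : Tendsto (fun n : ℕ => ∫ k in (-((n : ℝ) ^ 4))..((n : ℝ) ^ 4),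
      -2 * (⟪(a : H), R ((k : ℂ) - ε * Complex.I) a⟫).im) atTop
      (𝓝 (2 * Real.pi * ‖(a : H)‖ ^ 2)) := by
    have e : ∀ n : ℕ, ∫ k in (-((n : ℝ) ^ 4))..((n : ℝ) ^ 4),
      -2 * (⟪(a : H), R ((k : ℂ) - ε * Complex.I) a⟫).im =
      -2 * (∫ k in (-((n : ℝ) ^ 4))..((n : ℝ) ^ 4),
        g ((k : ℂ) - ε * Complex.I) / ((k : ℂ) - ε * Complex.I)).im +
        2 * ‖(a : H)‖ ^ 2 * ∫ k in (-((n : ℝ) ^ 4))..((n : ℝ) ^ 4), ε / (k ^ 2 + ε ^ 2) := by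
      intro n
      simp only [hpt]
      rw [intervalIntegral.integral_add, intervalIntegral.integral_const_mul,
        intervalIntegral.integral_const_mul]
      · congr 2
        exact Complex.imCLM.intervalIntegral_comp_comm (hgc.intervalIntegrable _ _)
      · exact (continuous_const.mul (Complex.continuous_im.comp hgc)).intervalIntegrable _ _
      · exact (hki.const_mul _).intervalIntegrable
    simp only [e]
    have t1 := ((Complex.continuous_im.tendsto 0).comp h0).const_mul (-2)
    have t2 := (intervalIntegral_tendsto_integral hki hKb hKt).const_mul (2 * ‖(a : H)‖ ^ 2)
    have t3 := t1.add t2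
    rw [hkv] at t3
    rw [Complex.zero_im, show (-2 : ℝ) * 0 + 2 * ‖(a : H)‖ ^ 2 * Real.pi
      = 2 * Real.pi * ‖(a : H)‖ ^ 2 by ring] at t3
    exact t3
  have hnn : ∀ k : ℝ, 0 ≤ -2 * (⟪(a : H), R ((k : ℂ) - ε * Complex.I) a⟫).im := by
    intro k
    rw [← aux_green A Γ hLag R hR G hG _ (by rw [him]; linarith), him, neg_neg]
    positivity
  have hint : Integrable (fun k : ℝ => -2 * (⟪(a : H), R ((k : ℂ) - ε * Complex.I) a⟫).im) := by
    refine integrable_of_intervalIntegral_norm_tendsto (2 * Real.pi * ‖(a : H)‖ ^ 2)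
      (fun n => hΦc.integrableOn_Ioc) hKb hKt ?_
    refine hlim.congr fun n => ?_
    congr 1
    funext k
    rw [Real.norm_of_nonneg (hnn k)]
  exact ⟨hint, tendsto_nhds_unique (intervalIntegral_tendsto_integral hint hKb hKt) hlim⟩

/-- The identity
`∫_ℝ ‖Γ(A-k+iε)⁻¹u‖² dk = 2π‖u‖² - 2ε ∫_ℝ ‖(A-k+iε)⁻¹u‖² dk` for all `ε > 0`. -/
theorem hardy_class_identity
    {E : Type*} [NormedAddCommGroup E] [InnerProductSpace ℂ E] [CompleteSpace E]
    (A : H →ₗ.[ℂ] H) (hA : IsMaxDissipative A)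
    (Γ : A.domain →ₗ[ℂ] E)
    (hΓb : ∃ C : ℝ, ∀ u : A.domain, ‖Γ u‖ ≤ C * (‖(u : H)‖ + ‖A u‖))
    (hΓd : DenseRange Γ)
    (hLag : ∀ u v : A.domain, ⟪(v : H), A u⟫ - ⟪A v, (u : H)⟫ = Complex.I * ⟪Γ v, Γ u⟫)
    (R : ℂ → H →L[ℂ] H) (hR : ∀ z : ℂ, z.im < 0 → IsResolventAt A z (R z))
    (G : ℂ → H →L[ℂ] E)   -- `G z = Γ (A - z)⁻¹`
    (hG : ∀ z : ℂ, z.im < 0 → ∀ u : A.domain, G z (A u - z • (u : H)) = Γ u)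
    (u : H) (ε : ℝ) (hε : 0 < ε) :
    Integrable (fun k : ℝ => ‖G ((k : ℂ) - ε * Complex.I) u‖ ^ 2) ∧
    Integrable (fun k : ℝ => ‖R ((k : ℂ) - ε * Complex.I) u‖ ^ 2) ∧
    (∫ k : ℝ, ‖G ((k : ℂ) - ε * Complex.I) u‖ ^ 2)
      = 2 * Real.pi * ‖u‖ ^ 2 - 2 * ε * ∫ k : ℝ, ‖R ((k : ℂ) - ε * Complex.I) u‖ ^ 2 := by
  classical
  have him : ∀ k : ℝ, ((k : ℂ) - ε * Complex.I).im = -ε := by intro k; simp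
  have hneg : ∀ k : ℝ, ((k : ℂ) - ε * Complex.I).im < 0 := by intro k; rw [him]; linarith
  have hgr := aux_green A Γ hLag R hR G hG
  have hb : ∀ z : ℂ, z.im < 0 → ∀ x, ‖R z x‖ * (-z.im) ≤ ‖x‖ := by
    intro z hz x
    have h1 := hgr z hz x
    have h2 : |(⟪x, R z x⟫).im| ≤ ‖x‖ * ‖R z x‖ :=
      (Complex.abs_im_le_norm _).trans (norm_inner_le_norm _ _)
    have h3 := neg_le_of_abs_le h2
    rcases (norm_nonneg (R z x)).eq_or_lt with h | h
    · rw [← h]; simp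
    · have h4 : (‖R z x‖ * (-z.im)) * ‖R z x‖ ≤ ‖x‖ * ‖R z x‖ := by
        nlinarith [sq_nonneg ‖G z x‖]
      exact le_of_mul_le_mul_right h4 h
  have hc : ∀ x, Continuous (fun k : ℝ => R ((k : ℂ) - ε * Complex.I) x) := by
    intro x
    rw [continuous_iff_continuousAt]
    intro k
    have h1 := (aux_res_deriv A R hR hb _ (hneg k) x).continuousAt
    have h2 : ContinuousAt (fun k : ℝ => (k : ℂ) - ε * Complex.I) k := by fun_prop
    exact ContinuousAt.comp (f := fun k : ℝ => (k : ℂ) - ε * Complex.I)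
      (g := fun z => R z x) h1 h2
  let F : H → ℝ → ℝ := fun x k => ‖G ((k : ℂ) - ε * Complex.I) x‖ ^ 2
    + 2 * ε * ‖R ((k : ℂ) - ε * Complex.I) x‖ ^ 2
  have hF : ∀ x k, F x k = -2 * (⟪x, R ((k : ℂ) - ε * Complex.I) x⟫).im := by
    intro x k
    have := hgr _ (hneg k) x
    rw [him, neg_neg] at this
    exact this
  have hF0 : ∀ x k, 0 ≤ F x k := fun x k => by positivity
  have hFc : ∀ x, Continuous (F x) := by
    intro x
    have : F x = fun k : ℝ => -2 * (⟪x, R ((k : ℂ) - ε * Complex.I) x⟫).im := funext (hF x)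
    rw [this]
    exact continuous_const.mul (Complex.continuous_im.comp (Continuous.inner continuous_const (hc _)))
  have hdom : ∀ a : A.domain, Integrable (F a) ∧ ∫ k, F a k = 2 * Real.pi * ‖(a : H)‖ ^ 2 := by
    intro a
    have := aux_dom A Γ hLag R hR G hG hb ε hε a hc
    rw [show F a = fun k : ℝ => -2 * (⟪(a : H), R ((k : ℂ) - ε * Complex.I) a⟫).im from funext (hF a)]
    exact this
  have hdense : Dense (A.domain : Set H) := hA.1.1
  have hle : ∀ x, ∫⁻ k, ENNReal.ofReal (F x k) ≤ ENNReal.ofReal (2 * Real.pi * ‖x‖ ^ 2) := by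
    intro x
    obtain ⟨s, hs, hsx⟩ := mem_closure_iff_seq_limit.mp (hdense x)
    have hpt : ∀ k, Filter.Tendsto (fun n => ENNReal.ofReal (F (s n) k)) Filter.atTop
        (nhds (ENNReal.ofReal (F x k))) := by
      intro k
      refine ENNReal.tendsto_ofReal ?_
      have : Continuous (fun y => F y k) := by
        simp only [F]; fun_prop
      exact (this.tendsto x).comp hsx
    have hf := lintegral_liminf_le (μ := volume) (u := Filter.atTop)
      (f := fun n k => ENNReal.ofReal (F (s n) k))
      (fun n => ENNReal.measurable_ofReal.comp (hFc (s n)).measurable)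
    simp only [fun k => (hpt k).liminf_eq] at hf
    refine hf.trans (le_of_eq ?_)
    have hv : ∀ n, ∫⁻ k, ENNReal.ofReal (F (s n) k) = ENNReal.ofReal (2 * Real.pi * ‖s n‖ ^ 2) := by
      intro n
      have := hdom ⟨s n, hs n⟩
      rw [← ofReal_integral_eq_lintegral_ofReal this.1 (Filter.Eventually.of_forall (hF0 _)), this.2]
    simp only [hv]
    refine Filter.Tendsto.liminf_eq (ENNReal.tendsto_ofReal ?_)
    exact ((hsx.norm.pow 2).const_mul _)
  have hint : ∀ x, Integrable (F x) := by
    intro x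
    refine ⟨(hFc x).aestronglyMeasurable, ?_⟩
    rw [hasFiniteIntegral_iff_ofReal (Filter.Eventually.of_forall (hF0 _))]
    exact (hle x).trans_lt ENNReal.ofReal_lt_top
  have hle' : ∀ x, ∫ k, F x k ≤ 2 * Real.pi * ‖x‖ ^ 2 := by
    intro x
    have h := hle x
    rw [← ofReal_integral_eq_lintegral_ofReal (hint x) (Filter.Eventually.of_forall (hF0 _))] at h
    exact (ENNReal.ofReal_le_ofReal_iff (by positivity)).mp h
  have hpar : ∀ x y, (∫ k, F (x + y) k) + (∫ k, F (x - y) k)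
      = 2 * (∫ k, F x k) + 2 * ∫ k, F y k := by
    intro x y
    rw [← integral_add (hint _) (hint _), ← integral_const_mul, ← integral_const_mul,
      ← integral_add ((hint _).const_mul _) ((hint _).const_mul _)]
    congr 1
    funext k
    simp only [F, map_add, map_sub]
    have h1 := parallelogram_law_with_norm ℂ (G ((k : ℂ) - ε * Complex.I) x)
      (G ((k : ℂ) - ε * Complex.I) y)
    have h2 := parallelogram_law_with_norm ℂ (R ((k : ℂ) - ε * Complex.I) x)
      (R ((k : ℂ) - ε * Complex.I) y)
    linear_combination h1 + 2 * ε * h2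
  have hint0 : ∀ x, 0 ≤ ∫ k, F x k := fun x => integral_nonneg (hF0 x)
  have heq : ∫ k, F u k = 2 * Real.pi * ‖u‖ ^ 2 := by
    refine le_antisymm (hle' u) ?_
    obtain ⟨s, hs, hsx⟩ := mem_closure_iff_seq_limit.mp (hdense u)
    have hd : ∀ n, 2 * Real.pi * ‖u‖ ^ 2 - ∫ k, F u k ≤ 4 * Real.pi * ‖u - s n‖ ^ 2 := by
      intro n
      have h1 := hpar (s n) (u - s n)
      have h2 := parallelogram_law_with_norm ℂ (s n) (u - s n)
      have h3 := (hdom ⟨s n, hs n⟩).2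
      have h4 := hle' (s n - (u - s n))
      have h5 := hint0 (u - s n)
      rw [add_sub_cancel] at h1 h2
      rw [h3] at h1
      have h6 := congrArg (fun t => 2 * Real.pi * t) h2
      linarith
    have hl : Filter.Tendsto (fun n => 4 * Real.pi * ‖u - s n‖ ^ 2) Filter.atTop (nhds 0) := by
      have := (((tendsto_const_nhds (x := u)).sub hsx).norm.pow 2).const_mul (4 * Real.pi)
      simpa using this
    have := ge_of_tendsto' hl hd
    linarith
  have hRi : Integrable (fun k : ℝ => ‖R ((k : ℂ) - ε * Complex.I) u‖ ^ 2) := by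
    refine ((hint u).const_mul (2 * ε)⁻¹).mono' ((hc u).norm.pow 2).aestronglyMeasurable
      (Filter.Eventually.of_forall fun k => ?_)
    rw [Real.norm_of_nonneg (by positivity), ← div_eq_inv_mul, le_div_iff₀ (by positivity)]
    simp only [F]
    nlinarith [sq_nonneg ‖G ((k : ℂ) - ε * Complex.I) u‖]
  have hGe : (fun k : ℝ => ‖G ((k : ℂ) - ε * Complex.I) u‖ ^ 2) =
      fun k => F u k - 2 * ε * ‖R ((k : ℂ) - ε * Complex.I) u‖ ^ 2 := by
    funext k; simp only [F]; ring
  refine ⟨?_, hRi, ?_⟩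
  · rw [hGe]; exact (hint u).sub (hRi.const_mul _)
  · rw [hGe, integral_sub (hint u) (hRi.const_mul _), integral_const_mul, heq]
end
end

section
/- For any maximally dissipative operator A on H and any u ∈ H: sup_{ε>0} ∫_ℝ ε‖(A − k + iε)^{-1}u‖²_H dk ≤ π‖u‖²_H. -/
open Complex MeasureTheory

noncomputable section

variable {H : Type*} [NormedAddCommGroup H] [InnerProductSpace ℂ H] [CompleteSpace H]

local notation "⟪" x ", " y "⟫" => @inner ℂ _ _ x y

lemma aux_kernel (ε r d t : ℝ) (hd : 0 < d) (hdr : d < r) :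
    d ^ 2 * (2 - d / r) / (d ^ 2 + t ^ 2) ≤
      (d / r) * poissonKernel (-(ε + r : ℝ) * I) (-(ε + d : ℝ) * I)
        (circleMap (-(ε + r : ℝ) * I) r (Real.pi / 2 - t / r)) := by
  have hr : 0 < r := hd.trans hdr
  set θ := Real.pi / 2 - t / r with hθ
  have hs : Real.sin θ = Real.cos (t / r) := by rw [hθ, Real.sin_pi_div_two_sub]
  have hcos := Real.one_sub_sq_div_two_le_cos (x := t / r)
  have hN : ‖circleMap (-(ε + r : ℝ) * I) r θ - (-(ε + r : ℝ) * I) -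
      ((-(ε + d : ℝ) * I) - (-(ε + r : ℝ) * I))‖ ^ 2 =
      d ^ 2 + 2 * r * (r - d) * (1 - Real.cos (t / r)) := by
    rw [circleMap_sub_center, ← normSq_eq_norm_sq, normSq_apply, ← hs]
    simp [circleMap, Complex.exp_re, Complex.exp_im]
    have := Real.sin_sq_add_cos_sq θ
    linear_combination (r ^ 2) * this
  have h1 : ‖circleMap (-(ε + r : ℝ) * I) r θ - (-(ε + r : ℝ) * I)‖ ^ 2 = r ^ 2 := by
    rw [circleMap_sub_center]; simp
  have h2 : ‖(-(ε + d : ℝ) * I : ℂ) - (-(ε + r : ℝ) * I)‖ ^ 2 = (r - d) ^ 2 := by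
    rw [← normSq_eq_norm_sq, normSq_apply]
    simp
    ring
  rw [poissonKernel_def, hN, h1, h2]
  have hle : d ^ 2 + 2 * r * (r - d) * (1 - Real.cos (t / r)) ≤ d ^ 2 + t ^ 2 := by
    have a : 2 * r * (r - d) * (1 - Real.cos (t / r)) ≤ 2 * r * (r - d) * ((t / r) ^ 2 / 2) := by
      apply mul_le_mul_of_nonneg_left
      · linarith
      · have : 0 < r - d := by linarith
        positivity
    have b : 2 * r * (r - d) * ((t / r) ^ 2 / 2) = t ^ 2 - (d / r) * t ^ 2 := by
      field_simp
    have : 0 ≤ d / r * t ^ 2 := by positivity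
    linarith
  have hpos : 0 < d ^ 2 + 2 * r * (r - d) * (1 - Real.cos (t / r)) := by
    have : 0 < r - d := by linarith
    have := Real.cos_le_one (t / r)
    have : 0 ≤ 1 - Real.cos (t / r) := by linarith
    positivity
  have he : d / r * ((r ^ 2 - (r - d) ^ 2) / (d ^ 2 + 2 * r * (r - d) * (1 - Real.cos (t / r))))
     = d ^ 2 * (2 - d / r) / (d ^ 2 + 2 * r * (r - d) * (1 - Real.cos (t / r))) := by
    rw [← mul_div_assoc]; congr 1; field_simp; ring
  rw [he]
  have : d / r < 1 := (div_lt_one hr).2 hdr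
  apply div_le_div_of_nonneg_left _ hpos hle
  have : 0 < 2 - d / r := by linarith
  positivity

lemma aux_finite (f : ℂ → ℂ) (hf : DifferentiableOn ℂ f {z | z.im < 0}) (C : ℝ)
    (hpos : ∀ z : ℂ, z.im < 0 → 0 ≤ (f z).im)
    (hb : ∀ z : ℂ, z.im < 0 → (f z).im * (-z.im) ≤ C) (ε r d : ℝ) (hε : 0 < ε)
    (hd : 0 < d) (hdr : d < r) :
    (∫ t in (-(Real.pi * r))..(Real.pi * r), d ^ 2 * (2 - d / r) / (d ^ 2 + t ^ 2) *
      (f (circleMap (-(ε + r : ℝ) * I) r (Real.pi / 2 - t / r))).im) ≤ 2 * (Real.pi * C) ∧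
    Continuous (fun t : ℝ => (f (circleMap (-(ε + r : ℝ) * I) r (Real.pi / 2 - t / r))).im) ∧
    ∀ t : ℝ, 0 ≤ (f (circleMap (-(ε + r : ℝ) * I) r (Real.pi / 2 - t / r))).im := by
  have hr : 0 < r := hd.trans hdr
  set c : ℂ := -(ε + r : ℝ) * I with hc
  set w : ℂ := -(ε + d : ℝ) * I with hw
  have hball : Metric.closedBall c r ⊆ {z : ℂ | z.im < 0} := by
    intro z hz
    rw [mem_closedBall_iff_norm] at hz
    have h1 := (Complex.abs_im_le_norm (z - c)).trans hz
    have h2 := (abs_le.1 h1).2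
    simp [hc] at h2
    simp
    linarith
  have hmem : ∀ θ, circleMap c r θ ∈ Metric.closedBall c r := fun θ =>
    circleMap_mem_closedBall c hr.le θ
  have hwb : w ∈ Metric.ball c r := by
    rw [mem_ball_iff_norm]
    have : w - c = ((r - d : ℝ) : ℂ) * I := by simp [hw, hc]; ring
    rw [this, norm_mul, Complex.norm_I, mul_one, Complex.norm_real, Real.norm_eq_abs, abs_of_pos]
      <;> linarith
  have hwn : w.im < 0 := hball (Metric.ball_subset_closedBall hwb)
  have hdc : DiffContOnCl ℂ f (Metric.ball c r) := by
    apply DifferentiableOn.diffContOnCl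
    rw [closure_ball c hr.ne']
    exact hf.mono hball
  have hcont : Continuous (fun θ => f (circleMap c r θ)) :=
    (hf.continuousOn).comp_continuous (continuous_circleMap c r) (fun θ => hball (hmem θ))
  have hKc : Continuous (fun θ => poissonKernel c w (circleMap c r θ)) := by
    rw [poissonKernel_eq_re_herglotzRieszKernel]
    apply Complex.continuous_re.comp
    apply (continuousOn_herglotzRieszKernel_sphere hwb).comp_continuous (continuous_circleMap c r)
    intro θ; exact circleMap_mem_sphere' c r θ
  have hP := hdc.circleAverage_poissonKernel_smul hwb
  set G : ℝ → ℝ := fun θ => poissonKernel c w (circleMap c r θ) * (f (circleMap c r θ)).im with hG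
  have hGc : Continuous G := hKc.mul (Complex.continuous_im.comp hcont)
  have hI : (∫ θ in (0:ℝ)..2 * Real.pi, G θ) = 2 * Real.pi * (f w).im := by
    rw [← hP, Real.circleAverage_def]
    have hint : IntervalIntegrable (fun θ => (poissonKernel c w • f) (circleMap c r θ)) volume 0 (2 * Real.pi) :=
      (hKc.smul hcont).intervalIntegrable _ _
    have := Complex.imCLM.intervalIntegral_comp_comm hint
    simp only [Complex.imCLM_apply] at this
    rw [Complex.smul_im, ← this]
    have : (fun θ => ((poissonKernel c w • f) (circleMap c r θ)).im) = G := by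
      ext θ; simp [hG]
    rw [this, smul_eq_mul]
    field_simp
  have hper : Function.Periodic G (2 * Real.pi) := by
    intro θ; simp only [hG, periodic_circleMap c r θ]
  have hsub : (∫ t in (-(Real.pi * r))..(Real.pi * r), G (Real.pi / 2 - t / r)) =
      r * (2 * Real.pi * (f w).im) := by
    rw [intervalIntegral.integral_comp_sub_div _ hr.ne', smul_eq_mul, ← hI]
    congr 1
    have := hper.intervalIntegral_add_eq (-(Real.pi/2)) 0
    rw [zero_add] at this
    rw [← this]
    congr 1 <;> field_simp <;> ring
  have hc2 : Continuous (fun t : ℝ => (f (circleMap c r (Real.pi / 2 - t / r))).im) :=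
    Complex.continuous_im.comp (hcont.comp (by fun_prop))
  have hp2 : ∀ t : ℝ, 0 ≤ (f (circleMap c r (Real.pi / 2 - t / r))).im := fun t =>
    hpos _ (hball (hmem _))
  refine ⟨?_, hc2, hp2⟩
  calc _ ≤ ∫ t in (-(Real.pi * r))..(Real.pi * r), (d / r) * G (Real.pi / 2 - t / r) := by
        apply intervalIntegral.integral_mono_on
        · have := Real.pi_pos
          have : 0 < Real.pi * r := by positivity
          linarith
        · apply Continuous.intervalIntegrable
          refine Continuous.mul ?_ hc2
          refine Continuous.div (by fun_prop) (by fun_prop) ?_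
          intro x; positivity
        · apply Continuous.intervalIntegrable
          have : Continuous fun t : ℝ => G (Real.pi / 2 - t / r) := hGc.comp (by fun_prop)
          fun_prop
        · intro t _
          simp only [hG]
          rw [← mul_assoc]
          exact mul_le_mul_of_nonneg_right (aux_kernel ε r d t hd hdr) (hp2 t)
    _ = 2 * Real.pi * (d * (f w).im) := by
        rw [intervalIntegral.integral_const_mul, hsub]; field_simp
    _ ≤ 2 * (Real.pi * C) := by
        have h1 := hb w hwn
        have h2 := hpos w hwn
        have h3 : -w.im = ε + d := by simp [hw]
        rw [h3] at h1
        have : d * (f w).im ≤ C := by nlinarith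
        have := mul_le_mul_of_nonneg_left this Real.pi_pos.le
        linarith

lemma aux_halfplane (f : ℂ → ℂ) (hf : DifferentiableOn ℂ f {z | z.im < 0}) (C : ℝ)
    (hpos : ∀ z : ℂ, z.im < 0 → 0 ≤ (f z).im)
    (hb : ∀ z : ℂ, z.im < 0 → (f z).im * (-z.im) ≤ C) (ε : ℝ) (hε : 0 < ε) :
    (∫⁻ k : ℝ, ENNReal.ofReal (f ((k : ℂ) - ε * I)).im) ≤ ENNReal.ofReal (Real.pi * C) := by
  let D : ℕ → ℝ := fun n => (n : ℝ) + 2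
  let Z : ℕ → ℝ → ℂ := fun n t =>
    circleMap (-(ε + (D n) ^ 2 : ℝ) * I) ((D n) ^ 2) (Real.pi / 2 - t / (D n) ^ 2)
  let g : ℕ → ℝ → ℝ := fun n t =>
    (D n) ^ 2 * (2 - D n / (D n) ^ 2) / ((D n) ^ 2 + t ^ 2) * (f (Z n t)).im
  let F : ℕ → ℝ → ENNReal := fun n =>
    (Set.Ioc (-(Real.pi * (D n) ^ 2)) (Real.pi * (D n) ^ 2)).indicator
      (fun t => ENNReal.ofReal (g n t))
  have hD : ∀ n, 2 ≤ D n := fun n => by simp [D]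
  have hD0 : ∀ n, 0 < D n := fun n => by linarith [hD n]
  have hD2 : ∀ n, D n < (D n) ^ 2 := fun n => by nlinarith [hD n]
  have hfin := fun n => aux_finite f hf C hpos hb ε ((D n) ^ 2) (D n) hε (hD0 n) (hD2 n)
  have hgc : ∀ n, Continuous (g n) := by
    intro n
    refine Continuous.mul ?_ (hfin n).2.1
    refine Continuous.div (by fun_prop) (by fun_prop) ?_
    intro x; have := hD0 n; positivity
  have hgn : ∀ n t, 0 ≤ g n t := by
    intro n t
    refine mul_nonneg ?_ ((hfin n).2.2 t)
    have h0 := hD0 n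
    have : D n / (D n) ^ 2 < 1 := (div_lt_one (by positivity)).2 (hD2 n)
    have : 0 < 2 - D n / (D n) ^ 2 := by linarith
    positivity
  have hFm : ∀ n, Measurable (F n) := fun n =>
    (ENNReal.measurable_ofReal.comp (hgc n).measurable).indicator measurableSet_Ioc
  have hFle : ∀ n, ∫⁻ t, F n t ≤ ENNReal.ofReal (2 * (Real.pi * C)) := by
    intro n
    have h0 := hD0 n
    have hle : -(Real.pi * (D n) ^ 2) ≤ Real.pi * (D n) ^ 2 := by
      have := Real.pi_pos
      have : 0 < Real.pi * (D n) ^ 2 := by positivity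
      linarith
    rw [lintegral_indicator measurableSet_Ioc,
      ← ofReal_integral_eq_lintegral_ofReal ((hgc n).integrableOn_Ioc) 
        (Filter.Eventually.of_forall (hgn n))]
    apply ENNReal.ofReal_le_ofReal
    rw [← intervalIntegral.integral_of_le hle]
    exact (hfin n).1
  have hDt : Filter.Tendsto D Filter.atTop Filter.atTop :=
    Filter.tendsto_atTop_add_const_right _ _ tendsto_natCast_atTop_atTop
  have hlim : ∀ t : ℝ, Filter.Tendsto (fun n => F n t) Filter.atTop
      (nhds (ENNReal.ofReal (2 * (f ((t : ℂ) - ε * I)).im))) := by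
    intro t
    have hinv : Filter.Tendsto (fun n => (D n)⁻¹) Filter.atTop (nhds 0) :=
      tendsto_inv_atTop_zero.comp hDt
    have hZ : Filter.Tendsto (fun n => Z n t) Filter.atTop (nhds ((t : ℂ) - ε * I)) := by
      -- exp difference quotient
      have hder : HasDerivAt (fun s : ℝ => I * cexp (-(s * t : ℝ) * I)) (t : ℂ) 0 := by
        have h1 : HasDerivAt (fun s : ℝ => (-(s * t : ℝ) * I : ℂ)) (-(t : ℂ) * I) 0 := by
          have := ((((hasDerivAt_id (0:ℝ)).mul_const t).ofReal_comp).neg).mul_const I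
          simpa using this
        have h2 := (h1.cexp).const_mul I
        have h4 : I * (cexp (-(((0 : ℝ) * t : ℝ) : ℂ) * I) * (-(t : ℂ) * I)) = t := by
          simp
          linear_combination (-(t:ℂ)) * I_mul_I
        rw [h4] at h2
        exact h2
      have hsl := hder.tendsto_slope_zero
      have hs : Filter.Tendsto (fun n => ((D n) ^ 2)⁻¹) Filter.atTop (nhdsWithin 0 {0}ᶜ) := by
        rw [tendsto_nhdsWithin_iff]
        constructor
        · have := hinv.pow 2
          simpa using this
        · refine Filter.Eventually.of_forall fun n => ?_
          have := hD0 n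
          have : ((D n) ^ 2)⁻¹ ≠ 0 := by positivity
          simpa using this
      have h3 := (hsl.comp hs).sub_const (ε * I : ℂ)
      refine h3.congr fun n => ?_
      simp only [Function.comp, Z, circleMap]
      have he : cexp (((Real.pi / 2 - t / (D n) ^ 2 : ℝ) : ℂ) * I) =
          I * cexp (-((((D n) ^ 2)⁻¹ * t : ℝ)) * I) := by
        have : (((Real.pi / 2 - t / (D n) ^ 2 : ℝ) : ℂ) * I) =
          Real.pi / 2 * I + (-((((D n) ^ 2)⁻¹ * t : ℝ)) * I) := by push_cast; ring
        rw [this, Complex.exp_add, Complex.exp_pi_div_two_mul_I]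
      rw [he]
      simp
      ring
    have hcf : ContinuousAt f ((t : ℂ) - ε * I) := by
      apply (hf.continuousOn).continuousAt
      apply (isOpen_lt Complex.continuous_im continuous_const).mem_nhds
      simpa using hε
    have him : Filter.Tendsto (fun n => (f (Z n t)).im) Filter.atTop
        (nhds (f ((t : ℂ) - ε * I)).im) :=
      (Complex.continuous_im.tendsto _).comp (hcf.tendsto.comp hZ)
    have hcoef : Filter.Tendsto (fun n => (D n) ^ 2 * (2 - D n / (D n) ^ 2) / ((D n) ^ 2 + t ^ 2))
        Filter.atTop (nhds 2) := by
      have : Filter.Tendsto (fun n => (2 - (D n)⁻¹) / (1 + t ^ 2 * ((D n)⁻¹) ^ 2)) Filter.atTop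
          (nhds ((2 - 0) / (1 + t ^ 2 * 0 ^ 2))) := by
        apply Filter.Tendsto.div
        · exact hinv.const_sub 2
        · exact ((hinv.pow 2).const_mul _).const_add 1
        · simp
      simp only [sub_zero, ne_eq, OfNat.ofNat_ne_zero, not_false_eq_true, zero_pow, mul_zero, add_zero, div_one] at this
      refine this.congr fun n => ?_
      have := hD0 n
      field_simp
    have hg : Filter.Tendsto (fun n => g n t) Filter.atTop
        (nhds (2 * (f ((t : ℂ) - ε * I)).im)) := hcoef.mul him
    refine (ENNReal.tendsto_ofReal hg).congr' ?_
    filter_upwards [hDt.eventually_gt_atTop |t|] with n hn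
    simp only [F]
    rw [Set.indicator_of_mem]
    have h1 := hD2 n
    have h2 := Real.pi_gt_three
    have h3 : |t| < Real.pi * (D n) ^ 2 := by nlinarith [hD n]
    exact ⟨(abs_lt.1 h3).1, (abs_lt.1 h3).2.le⟩
  have hfatou := lintegral_liminf_le (μ := volume) (u := Filter.atTop) hFm
  simp only [fun t => (hlim t).liminf_eq] at hfatou
  have hle2 : Filter.liminf (fun n => ∫⁻ t, F n t) Filter.atTop ≤ ENNReal.ofReal (2 * (Real.pi * C)) := by
    refine (Filter.liminf_le_liminf (Filter.Eventually.of_forall hFle)).trans ?_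
    simp
  have h := hfatou.trans hle2
  simp only [ENNReal.ofReal_mul (zero_le_two : (0:ℝ) ≤ 2)] at h
  rw [lintegral_const_mul' _ _ (by simp)] at h
  rwa [ENNReal.mul_le_mul_iff_right (by simp) (by simp)] at h

lemma aux_key (A : H →ₗ.[ℂ] H) (hA : IsDissipative A) (z : ℂ) (R : H →L[ℂ] H)
    (hR : IsResolventAt A z R) (h : H) :
    -z.im * ‖R h‖ ^ 2 ≤ (⟪R h, h⟫).im := by
  obtain ⟨v, hv, hv2⟩ := hR.2 h
  have h1 := hA.2 v
  rw [← hv]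
  conv_rhs => rw [← hv2]
  rw [inner_sub_right, inner_smul_right, inner_self_eq_norm_sq_to_K, Complex.sub_im]
  have : (z * ((‖(v : H)‖ : ℂ)) ^ 2).im = z.im * ‖(v : H)‖ ^ 2 := by
    rw [← Complex.ofReal_pow, Complex.im_mul_ofReal]
  simp only [Complex.coe_algebraMap] at *
  rw [this]
  linarith

lemma aux_norm (A : H →ₗ.[ℂ] H) (hA : IsDissipative A) (z : ℂ) (hz : z.im < 0) (R : H →L[ℂ] H)
    (hR : IsResolventAt A z R) (h : H) :
    -z.im * ‖R h‖ ≤ ‖h‖ := by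
  have h1 := aux_key A hA z R hR h
  have h2 : (⟪R h, h⟫).im ≤ ‖R h‖ * ‖h‖ :=
    ((le_abs_self _).trans (Complex.abs_im_le_norm _)).trans (norm_inner_le_norm _ _)
  rcases (norm_nonneg (R h)).eq_or_lt with h0 | h0
  · rw [← h0]; simp
  · have : ‖R h‖ * (-z.im * ‖R h‖) ≤ ‖R h‖ * ‖h‖ := by nlinarith
    exact le_of_mul_le_mul_left this h0

lemma aux_res (A : H →ₗ.[ℂ] H) (z w : ℂ) (Rz Rw : H →L[ℂ] H)
    (hz : IsResolventAt A z Rz) (hw : IsResolventAt A w Rw) (h : H) :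
    Rz h - Rw h = (z - w) • Rz (Rw h) := by
  obtain ⟨v, hv, hv2⟩ := hw.2 h
  have h1 := hz.1 v
  have h2 : A v - z • (v : H) = h - (z - w) • (v : H) := by
    rw [← hv2, sub_smul]; abel
  rw [h2, map_sub, map_smul] at h1
  rw [← hv, ← sub_eq_zero]
  rw [← sub_eq_zero] at h1
  rw [← h1]; abel

lemma aux_cont (A : H →ₗ.[ℂ] H) (hA : IsDissipative A)
    (R : ℂ → H →L[ℂ] H) (hR : ∀ z : ℂ, z.im < 0 → IsResolventAt A z (R z))
    (h : H) (w : ℂ) (hw : w.im < 0) : ContinuousAt (fun z => R z h) w := by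
  rw [ContinuousAt, tendsto_iff_norm_sub_tendsto_zero]
  have hlim : Filter.Tendsto (fun z : ℂ => ‖z - w‖ * (‖R w h‖ / (-z.im))) (nhds w) (nhds 0) := by
    have : ContinuousAt (fun z : ℂ => ‖z - w‖ * (‖R w h‖ / (-z.im))) w := by
      apply ContinuousAt.mul (by fun_prop)
      apply ContinuousAt.div continuousAt_const
      · exact Complex.continuous_im.continuousAt.neg
      · linarith
    have h2 := this.tendsto
    simpa using h2
  refine squeeze_zero' (Filter.Eventually.of_forall fun z => norm_nonneg _) ?_ hlim
  filter_upwards [(isOpen_lt Complex.continuous_im continuous_const).mem_nhds hw] with z hz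
  have hz : z.im < 0 := hz
  rw [aux_res A z w _ _ (hR z hz) (hR w hw) h, norm_smul]
  apply mul_le_mul_of_nonneg_left _ (norm_nonneg _)
  rw [le_div_iff₀ (by linarith)]
  have := aux_norm A hA z hz (R z) (hR z hz) (R w h)
  linarith

lemma aux_diff (A : H →ₗ.[ℂ] H) (hA : IsDissipative A)
    (R : ℂ → H →L[ℂ] H) (hR : ∀ z : ℂ, z.im < 0 → IsResolventAt A z (R z))
    (u : H) : DifferentiableOn ℂ (fun z => -⟪u, R z u⟫) {z | z.im < 0} := by
  intro w hw
  have hw : w.im < 0 := hw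
  have hd : HasDerivAt (fun z => R z u) (R w (R w u)) w := by
    rw [hasDerivAt_iff_tendsto_slope]
    have hc := (aux_cont A hA R hR (R w u) w hw).tendsto.mono_left
      (nhdsWithin_le_nhds (s := {w}ᶜ))
    refine hc.congr' ?_
    filter_upwards [mem_nhdsWithin_of_mem_nhds
      ((isOpen_lt Complex.continuous_im continuous_const).mem_nhds hw), self_mem_nhdsWithin]
      with z hz hne
    have hz : z.im < 0 := hz
    have hne : z - w ≠ 0 := sub_ne_zero.2 hne
    rw [slope_def_module, aux_res A z w _ _ (hR z hz) (hR w hw) u, smul_smul,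
      inv_mul_cancel₀ hne, one_smul]
  have h2 := ((innerSL ℂ u).hasFDerivAt.comp_hasDerivAt w hd).neg
  exact h2.differentiableAt.differentiableWithinAt

/-- For any maximally dissipative `A` and `u ∈ H`:
`sup_{ε>0} ∫_ℝ ε ‖(A-k+iε)⁻¹u‖² dk ≤ π ‖u‖²`. -/
theorem resolvent_integral_bound
    (A : H →ₗ.[ℂ] H) (hA : IsMaxDissipative A)
    (R : ℂ → H →L[ℂ] H) (hR : ∀ z : ℂ, z.im < 0 → IsResolventAt A z (R z))
    (u : H) :
    ∀ ε : ℝ, 0 < ε →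
      (∫⁻ k : ℝ, ENNReal.ofReal (ε * ‖R ((k : ℂ) - ε * Complex.I) u‖ ^ 2))
        ≤ ENNReal.ofReal (Real.pi * ‖u‖ ^ 2) := by
  intro ε hε
  have him : ∀ z : ℂ, (-⟪u, R z u⟫).im = (⟪R z u, u⟫).im := by
    intro z
    rw [← inner_conj_symm u (R z u), Complex.neg_im, Complex.conj_im, neg_neg]
  have hk : ∀ z : ℂ, z.im < 0 → -z.im * ‖R z u‖ ^ 2 ≤ (-⟪u, R z u⟫).im := fun z hz => by
    rw [him]; exact aux_key A hA.1 z (R z) (hR z hz) u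
  have hmain := aux_halfplane (fun z => -⟪u, R z u⟫) (aux_diff A hA.1 R hR u) (‖u‖ ^ 2)
    (fun z hz => by
      refine le_trans ?_ (hk z hz)
      have : 0 < -z.im := by linarith
      positivity)
    (fun z hz => by
      have h1 := aux_norm A hA.1 z hz (R z) (hR z hz) u
      have h2 : (-⟪u, R z u⟫).im ≤ ‖u‖ * ‖R z u‖ := by
        refine ((le_abs_self _).trans (Complex.abs_im_le_norm _)).trans ?_
        rw [norm_neg]; exact norm_inner_le_norm _ _
      have h3 : 0 < -z.im := by linarith
      calc (-⟪u, R z u⟫).im * (-z.im) ≤ ‖u‖ * ‖R z u‖ * (-z.im) :=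
            mul_le_mul_of_nonneg_right h2 h3.le
        _ = ‖u‖ * (-z.im * ‖R z u‖) := by ring
        _ ≤ ‖u‖ * ‖u‖ := mul_le_mul_of_nonneg_left h1 (norm_nonneg _)
        _ = ‖u‖ ^ 2 := by ring) ε hε
  refine le_trans (lintegral_mono fun k => ENNReal.ofReal_le_ofReal ?_) hmain
  have hz : ((k : ℂ) - ε * Complex.I).im = -ε := by simp
  have := hk ((k : ℂ) - ε * Complex.I) (by rw [hz]; linarith)
  rw [hz, neg_neg] at this
  exact this
end
end
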